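/- Bounds for the reduced-problem terms of the smooth component: Let y₀=(y₀₁,y₀₂)ᵀ solve the first-order system a₁(x)y₀₁'(x)−b₁₁(x)y₀₁(x)+b₁₂(x)y₀₂(x)=f₁(x), a₂(x)y₀₂'(x)+b₂₁(x)y₀₁(x)−b₂₂(x)y₀₂(x)=f₂(x) on (0,1) with y₀₁(1)=r₁, y₀₂(1)=r₂, and let y₁=(y₁₁,y₁₂)ᵀ solve a₁(x)y₁₁'(x)−b₁₁(x)y₁₁(x)+b₁₂(x)y₁₂(x)=−(ε₁/ε₂)y₀₁''(x), a₂(x)y₁₂'(x)+b₂₁(x)y₁₁(x)−b₂₂(x)y₁₂(x)=−y₀₂''(x) with y₁₁(1)=y₁₂(1)=0. Then there is a constant C, independent of ε₁ and ε₂, such that ‖y₀⁽ᵏ⁾‖ ≤ C and ‖y₁⁽ᵏ⁾‖ ≤ C for 0 ≤ k ≤ 3. -/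

import Mathlib

open Set

/-- `(u, v)` is a `C³` solution on `(0,1)` of the first-order system with right-hand side
`(g₁, g₂)`. -/
structure IsReducedSolution (a₁ a₂ b₁₁ b₁₂ b₂₁ b₂₂ g₁ g₂ u v : ℝ → ℝ) : Prop where
  contDiff_fst : ContDiff ℝ 3 u
  contDiff_snd : ContDiff ℝ 3 v
  eq : ∀ x ∈ Ioo (0:ℝ) 1, a₁ x * deriv u x - b₁₁ x * u x + b₁₂ x * v x = g₁ x ∧
    a₂ x * deriv v x + b₂₁ x * u x - b₂₂ x * v x = g₂ x

/-- One-sided energy estimate for a single equation `a * d = b * u - c * v`. -/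
theorem neg_mul_sq_le_mul_of_eq {α B a b c u v d : ℝ} (hα : 0 < α) (ha : α ≤ a) (hc : 0 < c)
    (hcB : c ≤ B) (hcb : c ≤ b) (h : a * d - b * u + c * v = 0) :
    -(B / α) * v ^ 2 ≤ u * d := by
  have ha0 : 0 < a := hα.trans_le ha
  have hB : 0 ≤ B := hc.le.trans hcB
  have h1 : B ≤ a * (B / α) := by
    have : B = α * (B / α) := by field_simp
    calc B = α * (B / α) := this
      _ ≤ a * (B / α) := by gcongr
  have h2 : 0 ≤ a * (u * d + B / α * v ^ 2) := by
    have e : a * (u * d + B / α * v ^ 2) = (b - c) * u ^ 2 + c * (u ^ 2 - u * v + v ^ 2)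
        + (B - c) * v ^ 2 + (a * (B / α) - B) * v ^ 2 := by
      linear_combination u * h
    rw [e]
    have : 0 ≤ u ^ 2 - u * v + v ^ 2 := by nlinarith [sq_nonneg (u - v), sq_nonneg (u + v)]
    have := sub_nonneg.2 hcb
    have := sub_nonneg.2 hcB
    have := sub_nonneg.2 h1
    positivity
  linarith [nonneg_of_mul_nonneg_right h2 ha0]

/-- A nonnegative function satisfying `w' ≥ -K w` on `(0,1)` and vanishing at `1` vanishes on
`[0,1]`. -/
theorem eq_zero_of_neg_mul_le_deriv {K : ℝ} {w : ℝ → ℝ} (hw : Differentiable ℝ w)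
    (hnonneg : ∀ x, 0 ≤ w x) (hd : ∀ x ∈ Ioo (0:ℝ) 1, -K * w x ≤ deriv w x) (h1 : w 1 = 0) :
    ∀ x ∈ Icc (0:ℝ) 1, w x = 0 := by
  have hD : ∀ x, HasDerivAt (fun x ↦ w x * Real.exp (K * x))
      (deriv w x * Real.exp (K * x) + w x * (Real.exp (K * x) * (K * 1))) x := fun x ↦
    (hw x).hasDerivAt.mul (((hasDerivAt_id x).const_mul K).exp)
  have hmono : MonotoneOn (fun x ↦ w x * Real.exp (K * x)) (Icc 0 1) := by
    apply monotoneOn_of_deriv_nonneg (convex_Icc 0 1)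
    · exact fun x _ ↦ (hD x).continuousAt.continuousWithinAt
    · exact fun x _ ↦ (hD x).differentiableAt.differentiableWithinAt
    · intro x hx
      rw [interior_Icc] at hx
      rw [(hD x).deriv]
      have := mul_nonneg (by linarith [hd x hx] : 0 ≤ deriv w x + K * w x)
        (Real.exp_pos (K * x)).le
      linarith
  intro x hx
  have h := hmono hx (right_mem_Icc.2 zero_le_one) hx.2
  simp only [h1, zero_mul] at h
  exact le_antisymm (nonpos_of_mul_nonpos_left h (Real.exp_pos _)) (hnonneg x)

/-- The homogeneous system with zero data at `1` has only the zero solution on `[0,1]`. -/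
theorem IsReducedSolution.eq_zero {α : ℝ} {a₁ a₂ b₁₁ b₁₂ b₂₁ b₂₂ u v : ℝ → ℝ} (hα : 0 < α)
    (hb₁₂c : Continuous b₁₂) (hb₂₁c : Continuous b₂₁)
    (ha₁ : ∀ x ∈ Icc (0:ℝ) 1, α ≤ a₁ x) (ha₂ : ∀ x ∈ Icc (0:ℝ) 1, α ≤ a₂ x)
    (hb₁ : ∀ x ∈ Icc (0:ℝ) 1, b₁₂ x ≤ b₁₁ x) (hb₂ : ∀ x ∈ Icc (0:ℝ) 1, b₂₁ x ≤ b₂₂ x)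
    (hb₁₂ : ∀ x ∈ Icc (0:ℝ) 1, 0 < b₁₂ x) (hb₂₁ : ∀ x ∈ Icc (0:ℝ) 1, 0 < b₂₁ x)
    (h : IsReducedSolution a₁ a₂ b₁₁ b₁₂ b₂₁ b₂₂ 0 0 u v) (hu : u 1 = 0) (hv : v 1 = 0) :
    EqOn u 0 (Icc 0 1) ∧ EqOn v 0 (Icc 0 1) := by
  obtain ⟨B₁, hB₁⟩ := isCompact_Icc.exists_bound_of_continuousOn (s := Icc (0:ℝ) 1)
    hb₁₂c.continuousOn
  obtain ⟨B₂, hB₂⟩ := isCompact_Icc.exists_bound_of_continuousOn (s := Icc (0:ℝ) 1)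
    hb₂₁c.continuousOn
  have hud := h.contDiff_fst.differentiable (by norm_num)
  have hvd := h.contDiff_snd.differentiable (by norm_num)
  have hw := eq_zero_of_neg_mul_le_deriv (K := 2 * (max B₁ B₂ / α))
    (w := fun x ↦ u x ^ 2 + v x ^ 2) (by fun_prop) (fun x ↦ by positivity) ?_ (by simp [hu, hv])
  · constructor <;> intro x hx <;> have := hw x hx <;> simp only [Pi.zero_apply] <;>
      nlinarith [sq_nonneg (u x), sq_nonneg (v x)]
  · intro x hx
    have hx' := Ioo_subset_Icc_self hx
    obtain ⟨e₁, e₂⟩ := h.eq x hx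
    have hD := (((hud x).hasDerivAt.pow 2).add ((hvd x).hasDerivAt.pow 2)).deriv
    have h₁ := neg_mul_sq_le_mul_of_eq hα (ha₁ x hx') (hb₁₂ x hx')
      (((le_abs_self _).trans (hB₁ x hx')).trans (le_max_left _ B₂)) (hb₁ x hx') e₁
    have h₂ := neg_mul_sq_le_mul_of_eq hα (ha₂ x hx') (hb₂₁ x hx')
      (((le_abs_self _).trans (hB₂ x hx')).trans (le_max_right B₁ _)) (hb₂ x hx')
      (show a₂ x * deriv v x - b₂₂ x * v x + b₂₁ x * u x = 0 by
        simpa [sub_add_eq_add_sub] using e₂)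
    have hD' : deriv (fun x ↦ u x ^ 2 + v x ^ 2) x = 2 * (u x * deriv u x + v x * deriv v x) := by
      refine Eq.trans hD ?_
      norm_num
      ring
    rw [hD']
    linarith

/-- Iterated derivatives on `[0,1]` of a `C³` function depend only on its values there. -/
theorem iteratedDeriv_eqOn_Icc {u v : ℝ → ℝ} (hu : ContDiff ℝ 3 u) (hv : ContDiff ℝ 3 v)
    (h : EqOn u v (Icc 0 1)) {k : ℕ} (hk : k ≤ 3) :
    EqOn (iteratedDeriv k u) (iteratedDeriv k v) (Icc 0 1) := by
  intro x hx
  have hk' : (k : WithTop ℕ∞) ≤ 3 := by exact_mod_cast hk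
  rw [← iteratedDerivWithin_eq_iteratedDeriv (uniqueDiffOn_Icc zero_lt_one)
      (hu.of_le hk').contDiffAt hx,
    ← iteratedDerivWithin_eq_iteratedDeriv (uniqueDiffOn_Icc zero_lt_one)
      (hv.of_le hk').contDiffAt hx]
  exact iteratedDerivWithin_congr h hx

theorem exists_bound_iteratedDeriv {u : ℝ → ℝ} (hu : ContDiff ℝ 3 u) :
    ∃ C : ℝ, 0 ≤ C ∧ ∀ x ∈ Icc (0:ℝ) 1, ∀ k ≤ 3, |iteratedDeriv k u x| ≤ C := by
  have h : ∀ k : ℕ, ∃ C : ℝ, k ≤ 3 → ∀ x ∈ Icc (0:ℝ) 1, |iteratedDeriv k u x| ≤ C := by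
    intro k
    by_cases hk : k ≤ 3
    · obtain ⟨C, hC⟩ := isCompact_Icc.exists_bound_of_continuousOn (s := Icc (0:ℝ) 1)
        (hu.continuous_iteratedDeriv k (by exact_mod_cast hk)).continuousOn
      exact ⟨C, fun _ ↦ hC⟩
    · exact ⟨0, fun h ↦ absurd h hk⟩
  choose C hC using h
  refine ⟨∑ k ∈ Finset.range 4, |C k|, by positivity, fun x hx k hk ↦ ?_⟩
  exact ((hC k hk x hx).trans (le_abs_self _)).trans
    (Finset.single_le_sum (f := fun k ↦ |C k|) (fun _ _ ↦ abs_nonneg _)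
      (Finset.mem_range.2 (by omega)))

/-- A bounded nonempty set of parameters is parametrized, with bounded coordinates, by an affine
frame of at most two of its members. -/
theorem exists_affine_frame {Y : Type*} (P : ℝ → Y → Prop) (hne : ∃ μ y, P μ y)
    (hb : ∀ μ y, P μ y → |μ| ≤ 1) :
    ∃ μ₀ y₀ μ₁ y₁, P μ₀ y₀ ∧ P μ₁ y₁ ∧ ∃ K : ℝ, 0 ≤ K ∧
      ∀ μ y, P μ y → ∃ t : ℝ, |t| ≤ K ∧ μ = μ₀ + t * (μ₁ - μ₀) := by
  obtain ⟨μ₀, y₀, h₀⟩ := hne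
  by_cases h : ∃ μ y, P μ y ∧ μ ≠ μ₀
  · obtain ⟨μ₁, y₁, h₁, hne⟩ := h
    have hd : μ₁ - μ₀ ≠ 0 := sub_ne_zero.2 hne
    refine ⟨μ₀, y₀, μ₁, y₁, h₀, h₁, 2 / |μ₁ - μ₀|, by positivity, fun μ y hy ↦
      ⟨(μ - μ₀) / (μ₁ - μ₀), ?_, by field_simp; ring⟩⟩
    rw [abs_div]
    gcongr
    exact (abs_sub _ _).trans (by linarith [hb μ y hy, hb μ₀ y₀ h₀])
  · push Not at h
    exact ⟨μ₀, y₀, μ₀, y₀, h₀, h₀, 0, le_rfl, fun μ y hy ↦ ⟨0, by simp, by simp [h μ y hy]⟩⟩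

/-- Affine combinations satisfy the iterated-derivative bound inherited from the two frame
functions. -/
theorem abs_iteratedDeriv_le_of_eqOn {u u₀ u₁ : ℝ → ℝ} {t K C₀ C₁ x : ℝ} {k : ℕ}
    (hu : ContDiff ℝ 3 u) (hu₀ : ContDiff ℝ 3 u₀) (hu₁ : ContDiff ℝ 3 u₁)
    (h : EqOn (u - (u₀ + t • (u₁ - u₀))) 0 (Icc 0 1)) (ht : |t| ≤ K) (hk : k ≤ 3)
    (hx : x ∈ Icc (0:ℝ) 1)
    (hC₀ : |iteratedDeriv k u₀ x| ≤ C₀) (hC₁ : |iteratedDeriv k u₁ x| ≤ C₁) :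
    |iteratedDeriv k u x| ≤ C₀ + K * (C₁ + C₀) := by
  have hk' : (k : WithTop ℕ∞) ≤ 3 := by exact_mod_cast hk
  have e := iteratedDeriv_eqOn_Icc (v := u₀ + t • (u₁ - u₀)) hu
    (hu₀.add ((hu₁.sub hu₀).const_smul t)) (fun y hy ↦ sub_eq_zero.1 (h hy)) hk hx
  have h₀ := (hu₀.of_le hk').contDiffAt (x := x)
  have h₁ := (hu₁.of_le hk').contDiffAt (x := x)
  rw [e, iteratedDeriv_add (g := t • (u₁ - u₀)) h₀ ((h₁.sub h₀).const_smul t),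
    iteratedDeriv_const_smul (f := u₁ - u₀) (h₁.sub h₀), iteratedDeriv_sub h₁ h₀, smul_eq_mul]
  have hK : 0 ≤ K := (abs_nonneg t).trans ht
  refine (abs_add_le _ _).trans (add_le_add hC₀ ?_)
  rw [abs_mul]
  gcongr
  exact (abs_sub _ _).trans (add_le_add hC₁ hC₀)


/-- Bounds, uniform in ε₁ and ε₂, for the terms y₀ and y₁ in the decomposition of
the smooth component. -/
theorem reduced_terms_bounds
    (α β : ℝ) (a₁ a₂ b₁₁ b₁₂ b₂₁ b₂₂ f₁ f₂ : ℝ → ℝ) (r₁ r₂ : ℝ)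
    (hα : 0 < α) (hβ : 0 < β)
    (ha₁s : ContDiff ℝ 3 a₁) (ha₂s : ContDiff ℝ 3 a₂)
    (hb₁₁s : ContDiff ℝ 3 b₁₁) (hb₁₂s : ContDiff ℝ 3 b₁₂)
    (hb₂₁s : ContDiff ℝ 3 b₂₁) (hb₂₂s : ContDiff ℝ 3 b₂₂)
    (hf₁s : ContDiff ℝ 3 f₁) (hf₂s : ContDiff ℝ 3 f₂)
    (ha₁ : ∀ x ∈ Icc (0:ℝ) 1, α ≤ a₁ x) (ha₂ : ∀ x ∈ Icc (0:ℝ) 1, α ≤ a₂ x)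
    (hb₁ : ∀ x ∈ Icc (0:ℝ) 1, β ≤ b₁₁ x - b₁₂ x)
    (hb₂ : ∀ x ∈ Icc (0:ℝ) 1, β ≤ b₂₂ x - b₂₁ x)
    (hb₁₂ : ∀ x ∈ Icc (0:ℝ) 1, 0 < b₁₂ x) (hb₂₁ : ∀ x ∈ Icc (0:ℝ) 1, 0 < b₂₁ x) :
    ∃ C : ℝ, 0 < C ∧
      ∀ ε₁ ε₂ : ℝ, 0 < ε₁ → ε₁ < ε₂ →
      ∀ y₀₁ y₀₂ y₁₁ y₁₂ : ℝ → ℝ,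
        ContDiff ℝ 3 y₀₁ → ContDiff ℝ 3 y₀₂ → ContDiff ℝ 3 y₁₁ → ContDiff ℝ 3 y₁₂ →
        (∀ x ∈ Ioo (0:ℝ) 1,
          a₁ x * deriv y₀₁ x - b₁₁ x * y₀₁ x + b₁₂ x * y₀₂ x = f₁ x ∧
          a₂ x * deriv y₀₂ x + b₂₁ x * y₀₁ x - b₂₂ x * y₀₂ x = f₂ x) →
        y₀₁ 1 = r₁ → y₀₂ 1 = r₂ →
        (∀ x ∈ Ioo (0:ℝ) 1,
          a₁ x * deriv y₁₁ x - b₁₁ x * y₁₁ x + b₁₂ x * y₁₂ x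
            = -(ε₁ / ε₂) * deriv (deriv y₀₁) x ∧
          a₂ x * deriv y₁₂ x + b₂₁ x * y₁₁ x - b₂₂ x * y₁₂ x
            = -(deriv (deriv y₀₂) x)) →
        y₁₁ 1 = 0 → y₁₂ 1 = 0 →
        ∀ x ∈ Icc (0:ℝ) 1, ∀ k ≤ 3,
          |iteratedDeriv k y₀₁ x| ≤ C ∧ |iteratedDeriv k y₀₂ x| ≤ C ∧
          |iteratedDeriv k y₁₁ x| ≤ C ∧ |iteratedDeriv k y₁₂ x| ≤ C := by
  have zero := fun u v ↦ IsReducedSolution.eq_zero (b₁₁ := b₁₁) (b₂₂ := b₂₂) (u := u) (v := v)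
    hα hb₁₂s.continuous hb₂₁s.continuous ha₁ ha₂
    (fun x hx ↦ by linarith [hb₁ x hx]) (fun x hx ↦ by linarith [hb₂ x hx]) hb₁₂ hb₂₁
  let Sol := IsReducedSolution a₁ a₂ b₁₁ b₁₂ b₂₁ b₂₂
  let P : ℝ → (ℝ → ℝ) × (ℝ → ℝ) × (ℝ → ℝ) × (ℝ → ℝ) → Prop := fun μ y ↦
    |μ| ≤ 1 ∧ Sol f₁ f₂ y.1 y.2.1 ∧ y.1 1 = r₁ ∧ y.2.1 1 = r₂ ∧
      Sol (fun x ↦ -μ * deriv (deriv y.1) x) (fun x ↦ -(deriv (deriv y.2.1) x)) y.2.2.1 y.2.2.2 ∧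
      y.2.2.1 1 = 0 ∧ y.2.2.2 1 = 0
  suffices H : ∃ C : ℝ, ∀ μ y, P μ y → ∀ x ∈ Icc (0:ℝ) 1, ∀ k ≤ 3,
      |iteratedDeriv k y.1 x| ≤ C ∧ |iteratedDeriv k y.2.1 x| ≤ C ∧
      |iteratedDeriv k y.2.2.1 x| ≤ C ∧ |iteratedDeriv k y.2.2.2 x| ≤ C by
    obtain ⟨C, hC⟩ := H
    refine ⟨max C 1, by positivity, ?_⟩
    intro ε₁ ε₂ hε₁ hε y₀₁ y₀₂ y₁₁ y₁₂ c₁ c₂ c₃ c₄ e₀ i₁ i₂ e₁ i₃ i₄ x hx k hk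
    have hμ : |ε₁ / ε₂| ≤ 1 := by
      rw [abs_of_pos (div_pos hε₁ (hε₁.trans hε))]
      exact (div_le_one (hε₁.trans hε)).2 hε.le
    obtain ⟨h₁, h₂, h₃, h₄⟩ := hC (ε₁ / ε₂) (y₀₁, y₀₂, y₁₁, y₁₂)
      ⟨hμ, ⟨c₁, c₂, e₀⟩, i₁, i₂, ⟨c₃, c₄, e₁⟩, i₃, i₄⟩ x hx k hk
    exact ⟨h₁.trans (le_max_left _ _), h₂.trans (le_max_left _ _), h₃.trans (le_max_left _ _),
      h₄.trans (le_max_left _ _)⟩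
  by_cases hne : ∃ μ y, P μ y
  swap
  · exact ⟨0, fun μ y hy ↦ absurd ⟨μ, y, hy⟩ hne⟩
  obtain ⟨μ₀, ⟨p, q, u₀, v₀⟩, μ₁, ⟨p₁, q₁, u₁, v₁⟩, hP₀, hP₁, K, hK, hframe⟩ :=
    exists_affine_frame P hne (fun _ _ h ↦ h.1)
  obtain ⟨-, s, ip, iq, s₀, iu₀, iv₀⟩ := id hP₀
  have agree : ∀ μ y, P μ y →
      EqOn (y.1 - (p + (0 : ℝ) • (p - p))) 0 (Icc 0 1) ∧
      EqOn (y.2.1 - (q + (0 : ℝ) • (q - q))) 0 (Icc 0 1) := by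
    rintro μ ⟨y, z, _, _⟩ ⟨-, sy, iy, iz, -⟩
    simp only [zero_smul, add_zero]
    refine zero _ _ ⟨sy.contDiff_fst.sub s.contDiff_fst, sy.contDiff_snd.sub s.contDiff_snd, ?_⟩
      (by simp_all) (by simp_all)
    intro x hx
    obtain ⟨e₁, e₂⟩ := sy.eq x hx
    obtain ⟨e₃, e₄⟩ := s.eq x hx
    have dy := sy.contDiff_fst.differentiable (by norm_num) x
    have dz := sy.contDiff_snd.differentiable (by norm_num) x
    have dp := s.contDiff_fst.differentiable (by norm_num) x
    have dq := s.contDiff_snd.differentiable (by norm_num) x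
    rw [deriv_sub dy dp, deriv_sub dz dq]
    simp only [Pi.sub_apply, Pi.zero_apply]
    exact ⟨by linear_combination e₁ - e₃, by linear_combination e₂ - e₄⟩
  have agree₂ : ∀ μ y, P μ y → ∀ x ∈ Ioo (0:ℝ) 1,
      deriv (deriv y.1) x = deriv (deriv p) x ∧ deriv (deriv y.2.1) x = deriv (deriv q) x := by
    intro μ y hy x hx
    obtain ⟨h₁, h₂⟩ := agree μ y hy
    simp only [zero_smul, add_zero] at h₁ h₂
    have k₁ := iteratedDeriv_eqOn_Icc hy.2.1.contDiff_fst s.contDiff_fst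
      (fun x hx ↦ sub_eq_zero.1 (h₁ hx)) (k := 2) (by norm_num) (Ioo_subset_Icc_self hx)
    have k₂ := iteratedDeriv_eqOn_Icc hy.2.1.contDiff_snd s.contDiff_snd
      (fun x hx ↦ sub_eq_zero.1 (h₂ hx)) (k := 2) (by norm_num) (Ioo_subset_Icc_self hx)
    simpa only [iteratedDeriv_succ, iteratedDeriv_zero] using And.intro k₁ k₂
  obtain ⟨-, -, -, -, s₁, iu₁, iv₁⟩ := id hP₁
  obtain ⟨Cp, hCp, Bp⟩ := exists_bound_iteratedDeriv s.contDiff_fst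
  obtain ⟨Cq, hCq, Bq⟩ := exists_bound_iteratedDeriv s.contDiff_snd
  obtain ⟨Cu₀, hCu₀, Bu₀⟩ := exists_bound_iteratedDeriv s₀.contDiff_fst
  obtain ⟨Cv₀, hCv₀, Bv₀⟩ := exists_bound_iteratedDeriv s₀.contDiff_snd
  obtain ⟨Cu₁, hCu₁, Bu₁⟩ := exists_bound_iteratedDeriv s₁.contDiff_fst
  obtain ⟨Cv₁, hCv₁, Bv₁⟩ := exists_bound_iteratedDeriv s₁.contDiff_snd
  refine ⟨Cp + Cq + (Cu₀ + K * (Cu₁ + Cu₀)) + (Cv₀ + K * (Cv₁ + Cv₀)), ?_⟩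
  intro μ y hy x hx k hk
  obtain ⟨t, ht, hμ⟩ := hframe μ y hy
  obtain ⟨hp, hq⟩ := agree μ y hy
  have hyd := agree₂ μ y hy
  have hPd := agree₂ μ₁ _ hP₁
  obtain ⟨y, z, u, v⟩ := y
  obtain ⟨-, sy, -, -, sc, iu, iv⟩ := hy
  have huv : EqOn (u - (u₀ + t • (u₁ - u₀))) 0 (Icc 0 1) ∧
      EqOn (v - (v₀ + t • (v₁ - v₀))) 0 (Icc 0 1) := by
    refine zero _ _ ⟨sc.contDiff_fst.sub
      (s₀.contDiff_fst.add ((s₁.contDiff_fst.sub s₀.contDiff_fst).const_smul t)),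
      sc.contDiff_snd.sub
      (s₀.contDiff_snd.add ((s₁.contDiff_snd.sub s₀.contDiff_snd).const_smul t)), ?_⟩
      (by simp_all) (by simp_all)
    intro x hx
    obtain ⟨e₁, e₂⟩ := sc.eq x hx
    obtain ⟨e₃, e₄⟩ := s₀.eq x hx
    obtain ⟨e₅, e₆⟩ := s₁.eq x hx
    obtain ⟨k₁, k₂⟩ := hyd x hx
    obtain ⟨k₃, k₄⟩ := hPd x hx
    simp only at e₁ e₂ e₃ e₄ e₅ e₆ k₁ k₂ k₃ k₄
    rw [k₁] at e₁
    rw [k₂] at e₂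
    rw [k₃] at e₅
    rw [k₄] at e₆
    have du := (sc.contDiff_fst.differentiable (by norm_num) x).hasDerivAt
    have dv := (sc.contDiff_snd.differentiable (by norm_num) x).hasDerivAt
    have du₀ := (s₀.contDiff_fst.differentiable (by norm_num) x).hasDerivAt
    have dv₀ := (s₀.contDiff_snd.differentiable (by norm_num) x).hasDerivAt
    have du₁ := (s₁.contDiff_fst.differentiable (by norm_num) x).hasDerivAt
    have dv₁ := (s₁.contDiff_snd.differentiable (by norm_num) x).hasDerivAt
    rw [(du.sub (du₀.add ((du₁.sub du₀).const_smul t))).deriv,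
      (dv.sub (dv₀.add ((dv₁.sub dv₀).const_smul t))).deriv]
    simp only [Pi.sub_apply, Pi.add_apply, Pi.smul_apply, smul_eq_mul, Pi.zero_apply]
    subst hμ
    exact ⟨by linear_combination e₁ - (e₃ + t * (e₅ - e₃)),
      by linear_combination e₂ - (e₄ + t * (e₆ - e₄))⟩
  have b₁ := abs_iteratedDeriv_le_of_eqOn sy.contDiff_fst s.contDiff_fst s.contDiff_fst hp
    (K := 0) (by simp) hk hx (Bp x hx k hk) (Bp x hx k hk)
  have b₂ := abs_iteratedDeriv_le_of_eqOn sy.contDiff_snd s.contDiff_snd s.contDiff_snd hq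
    (K := 0) (by simp) hk hx (Bq x hx k hk) (Bq x hx k hk)
  have b₃ := abs_iteratedDeriv_le_of_eqOn sc.contDiff_fst s₀.contDiff_fst s₁.contDiff_fst huv.1
    ht hk hx (Bu₀ x hx k hk) (Bu₁ x hx k hk)
  have b₄ := abs_iteratedDeriv_le_of_eqOn sc.contDiff_snd s₀.contDiff_snd s₁.contDiff_snd huv.2
    ht hk hx (Bv₀ x hx k hk) (Bv₁ x hx k hk)
  have hKu : 0 ≤ K * (Cu₁ + Cu₀) := by positivity
  have hKv : 0 ≤ K * (Cv₁ + Cv₀) := by positivity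
  refine ⟨?_, ?_, ?_, ?_⟩ <;> linarith
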